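/- arXiv:0910.0582 — 5 statements merged into one kernel-verified Lean document; each statement's English description precedes it below -/
import Mathlib

section
/- If a finite simple graph G has a vertex cover of size at most k, then G has neighborhood diversity at most 2^k + k; that is, the vertex set of G can be partitioned into at most 2^k + k parts such that any two vertices in the same part have the same type. -/
/-- Two vertices `v, v'` of a simple graph `G` have the *same type* if
`N(v) \ {v'} = N(v') \ {v}`, where `N(u)` is the open neighborhood of `u`. -/
def SimpleGraph.SameType {V : Type*} (G : SimpleGraph V) (v v' : V) : Prop :=
  G.neighborSet v \ {v'} = G.neighborSet v' \ {v}

/-- If a finite simple graph `G` has a vertex cover of size at most `k`, then its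
vertex set can be partitioned into at most `2^k + k` parts (the fibers of a map
into `Fin (2^k + k)`) such that any two vertices in the same part have the same
type; i.e. `G` has neighborhood diversity at most `2^k + k`. -/
theorem nd_le_of_vertexCover {V : Type*} [Fintype V] (G : SimpleGraph V) (k : ℕ)
    (C : Finset V) (hC : ∀ u w : V, G.Adj u w → u ∈ C ∨ w ∈ C) (hCk : C.card ≤ k) :
    ∃ f : V → Fin (2 ^ k + k), ∀ v v' : V, f v = f v' → G.SameType v v' := by
  classical
  have hcard : Fintype.card (Finset C ⊕ C) ≤ Fintype.card (Fin (2 ^ k + k)) := by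
    simp only [Fintype.card_sum, Fintype.card_finset, Fintype.card_coe, Fintype.card_fin]
    exact Nat.add_le_add (Nat.pow_le_pow_right (by norm_num) hCk) hCk
  obtain ⟨e⟩ := Function.Embedding.nonempty_of_card_le hcard
  let g : V → Finset C ⊕ C := fun v =>
    if h : v ∈ C then Sum.inr ⟨v, h⟩
    else Sum.inl (Finset.univ.filter fun c : C => G.Adj v c)
  refine ⟨fun v => e (g v), fun v v' h => ?_⟩
  have hg : g v = g v' := e.injective h
  by_cases hv : v ∈ C <;> by_cases hv' : v' ∈ C
  · have : v = v' := by simpa [g, hv, hv'] using hg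
    subst this
    rfl
  · simp [g, hv, hv'] at hg
  · simp [g, hv, hv'] at hg
  · have h1 : ∀ c ∈ C, (G.Adj v c ↔ G.Adj v' c) := by
      intro c hc
      simp only [g, hv, hv', dite_false, Sum.inl.injEq] at hg
      have := Finset.ext_iff.mp hg ⟨c, hc⟩
      simpa using this
    have h2 : ∀ x, (G.Adj v x ↔ G.Adj v' x) := by
      intro x
      by_cases hx : x ∈ C
      · exact h1 x hx
      · exact ⟨fun a => ((hC _ _ a).elim hv hx).elim, fun a => ((hC _ _ a).elim hv' hx).elim⟩
    ext x
    simp only [Set.mem_diff, SimpleGraph.mem_neighborSet, Set.mem_singleton_iff]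
    constructor
    · rintro ⟨a, -⟩
      exact ⟨(h2 x).1 a, fun hx => G.loopless.irrefl v (hx ▸ a)⟩
    · rintro ⟨a, -⟩
      exact ⟨(h2 x).2 a, fun hx => G.loopless.irrefl v' (hx ▸ a)⟩
end

section
/- Let G be a simple graph and let σ be a permutation of the vertex set of G such that for every vertex v, the vertices v and σ(v) have the same type. Then σ is an automorphism of G. -/
/-- If `σ` is a permutation of the vertex set of `G` such that every vertex `v` has
the same type as `σ v`, then `σ` is an automorphism of `G`. -/
theorem perm_isAutomorphism {V : Type*} (G : SimpleGraph V) (σ : Equiv.Perm V)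
    (h : ∀ v : V, G.SameType v (σ v)) :
    ∀ u w : V, G.Adj u w ↔ G.Adj (σ u) (σ w) := by
  have key : ∀ v x : V, x ≠ v → x ≠ σ v → (G.Adj v x ↔ G.Adj (σ v) x) := by
    intro v x h1 h2
    have h3 := Set.ext_iff.mp (h v) x
    simpa [h1, h2] using h3
  intro u w
  by_cases huw : u = w
  · subst huw
    simp
  have hs : σ u ≠ σ w := fun e => huw (σ.injective e)
  by_cases h1 : w = σ u
  · by_cases h2 : u = σ w
    · rw [← h1, ← h2]
      exact G.adj_comm u w
    · rw [G.adj_comm u w, key w u huw h2, G.adj_comm (σ w) u]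
      exact key u (σ w) (Ne.symm h2) hs.symm
  · rw [key u w (Ne.symm huw) h1, G.adj_comm (σ u) w, G.adj_comm (σ u) (σ w)]
    exact key w (σ u) (Ne.symm h1) hs
end

section
/- Let G be a simple graph and let S₁, S₂ be sets of vertices of G such that all vertices of the symmetric difference (S₁ ∖ S₂) ∪ (S₂ ∖ S₁) pairwise have the same type, the sets S₁ ∖ S₂ and S₂ ∖ S₁ are finite, and |S₁ ∖ S₂| = |S₂ ∖ S₁|. Then there exists an automorphism σ of G such that σ maps S₁ onto S₂ and σ fixes every vertex outside (S₁ ∖ S₂) ∪ (S₂ ∖ S₁). -/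
theorem swap_adj_aux {V : Type*} {G : SimpleGraph V} {D : Set V}
    (h : ∀ v ∈ D, ∀ v' ∈ D, G.SameType v v') {a b c : V} (ha : a ∈ D) (hb : b ∈ D)
    (hca : c ≠ a) (hcb : c ≠ b) : G.Adj a c ↔ G.Adj b c := by
  have := Set.ext_iff.1 (h a ha b hb) c
  simpa [hca, hcb] using this

theorem four_adj_aux {V : Type*} {G : SimpleGraph V} {D : Set V}
    (h : ∀ v ∈ D, ∀ v' ∈ D, G.SameType v v') {a b c d : V} (ha : a ∈ D) (hb : b ∈ D)
    (hc : c ∈ D) (hd : d ∈ D) (hab : a ≠ b) (hcd : c ≠ d) : G.Adj a b ↔ G.Adj c d := by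
  by_cases hda : d = a
  · subst hda
    rw [G.adj_comm, swap_adj_aux h hb hc hab hcd.symm]
  · rw [G.adj_comm, swap_adj_aux h hb hd hab (Ne.symm hda), G.adj_comm,
      swap_adj_aux h ha hc hda hcd.symm]

theorem perm_adj_aux {V : Type*} {G : SimpleGraph V} {D : Set V}
    (h : ∀ v ∈ D, ∀ v' ∈ D, G.SameType v v') (σ : Equiv.Perm V)
    (hD : ∀ v ∈ D, σ v ∈ D) (hf : ∀ v ∉ D, σ v = v) (u w : V) :
    G.Adj u w ↔ G.Adj (σ u) (σ w) := by
  by_cases huw : u = w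
  · subst huw; simp
  by_cases hu : u ∈ D <;> by_cases hw : w ∈ D
  · exact four_adj_aux h hu hw (hD _ hu) (hD _ hw) huw (fun e => huw (σ.injective e))
  · rw [hf w hw]
    exact swap_adj_aux h hu (hD _ hu) (Ne.symm huw) (fun e => hw (e ▸ hD _ hu))
  · rw [hf u hu, G.adj_comm u, G.adj_comm u]
    exact swap_adj_aux h hw (hD _ hw) huw (fun e => hu (e ▸ hD _ hw))
  · rw [hf u hu, hf w hw]

/-- If all vertices of the symmetric difference of `S₁` and `S₂` pairwise have the
same type, the sets `S₁ \ S₂` and `S₂ \ S₁` are finite and have the same cardinality,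
then there is an automorphism of `G` mapping `S₁` onto `S₂` and fixing every vertex
outside the symmetric difference. -/
theorem exists_automorphism_mapping_set {V : Type*} (G : SimpleGraph V)
    (S₁ S₂ : Set V)
    (htype : ∀ v ∈ (S₁ \ S₂) ∪ (S₂ \ S₁), ∀ v' ∈ (S₁ \ S₂) ∪ (S₂ \ S₁),
      G.SameType v v')
    (hfin₁ : (S₁ \ S₂).Finite) (hfin₂ : (S₂ \ S₁).Finite)
    (hcard : (S₁ \ S₂).ncard = (S₂ \ S₁).ncard) :
    ∃ σ : Equiv.Perm V, (∀ u w : V, G.Adj u w ↔ G.Adj (σ u) (σ w)) ∧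
      σ '' S₁ = S₂ ∧ ∀ v ∉ (S₁ \ S₂) ∪ (S₂ \ S₁), σ v = v := by
  classical
  have := hfin₁.to_subtype
  have := hfin₂.to_subtype
  let e : ↥(S₁ \ S₂) ≃ ↥(S₂ \ S₁) :=
    (Finite.card_eq.1 hcard).some
  let f : V → V := fun v => if h : v ∈ S₁ \ S₂ then (e ⟨v, h⟩ : V) else
    if h : v ∈ S₂ \ S₁ then (e.symm ⟨v, h⟩ : V) else v
  have f1 : ∀ v (h : v ∈ S₁ \ S₂), f v = e ⟨v, h⟩ := fun v h => dif_pos h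
  have f2 : ∀ v (h : v ∈ S₂ \ S₁), f v = e.symm ⟨v, h⟩ := fun v h => by
    have h' : v ∉ S₁ \ S₂ := fun h' => h.2 h'.1
    simp only [f, dif_neg h', dif_pos h]
  have f3 : ∀ v ∉ (S₁ \ S₂) ∪ (S₂ \ S₁), f v = v := fun v h => by
    have h1 : v ∉ S₁ \ S₂ := fun h' => h (Or.inl h')
    have h2 : v ∉ S₂ \ S₁ := fun h' => h (Or.inr h')
    simp only [f, dif_neg h1, dif_neg h2]
  have m1 : ∀ v ∈ S₁ \ S₂, f v ∈ S₂ \ S₁ := fun v h => by rw [f1 v h]; exact (e _).2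
  have m2 : ∀ v ∈ S₂ \ S₁, f v ∈ S₁ \ S₂ := fun v h => by rw [f2 v h]; exact (e.symm _).2
  have inv : Function.Involutive f := by
    intro v
    by_cases h1 : v ∈ S₁ \ S₂
    · rw [f2 _ (m1 v h1)]; simp [f1 v h1]
    by_cases h2 : v ∈ S₂ \ S₁
    · rw [f1 _ (m2 v h2)]; simp [f2 v h2]
    have h3 : v ∉ (S₁ \ S₂) ∪ (S₂ \ S₁) := fun h => h.elim h1 h2
    rw [f3 v h3, f3 v h3]
  have k1 : ∀ v ∈ S₁, f v ∈ S₂ := fun v h => by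
    by_cases h2 : v ∈ S₂
    · rw [f3 v (fun h' => h'.elim (fun x => x.2 h2) (fun x => x.2 h))]; exact h2
    · exact (m1 v ⟨h, h2⟩).1
  have k2 : ∀ v ∈ S₂, f v ∈ S₁ := fun v h => by
    by_cases h2 : v ∈ S₁
    · rw [f3 v (fun h' => h'.elim (fun x => x.2 h) (fun x => x.2 h2))]; exact h2
    · exact (m2 v ⟨h, h2⟩).1
  refine ⟨inv.toPerm f, perm_adj_aux htype _ ?_ f3, ?_, f3⟩
  · rintro v (h | h)
    · exact Or.inr (m1 v h)
    · exact Or.inl (m2 v h)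
  · ext v
    constructor
    · rintro ⟨u, hu, rfl⟩; exact k1 u hu
    · intro h; exact ⟨f v, k2 v h, inv v⟩
end

section
/- Let G be a simple graph, viewed as a structure in the first-order language of graphs (one binary adjacency relation). Let φ be a first-order formula in this language whose free variables are indexed by a set α together with one distinguished extra free variable. Let v, v′ be two vertices of G that have the same type, and let a : α → V be any assignment of the α-indexed free variables to vertices such that a(i) ≠ v and a(i) ≠ v′ for every i ∈ α. Then φ is realized in G under the assignment sending the distinguished variable to v and the remaining variables according to a if and only if it is realized under the assignment sending the distinguished variable to v′ and the remaining variables according to a. -/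
open FirstOrder

/-- Realization of a first-order formula in the language of graphs in the structure
corresponding to the simple graph `G`, under the assignment `x` of its free
variables. -/
def SimpleGraph.Realizes {V : Type*} (G : SimpleGraph V) {α : Type*}
    (φ : Language.graph.Formula α) (x : α → V) : Prop :=
  letI := G.structure
  φ.Realize x

theorem sameType_swap_adj {V : Type*} [DecidableEq V] (G : SimpleGraph V) (v v' : V)
    (h : G.SameType v v') (x y : V) :
    G.Adj (Equiv.swap v v' x) (Equiv.swap v v' y) ↔ G.Adj x y := by
  have h1 : ∀ w, (G.Adj v w ∧ w ≠ v') ↔ (G.Adj v' w ∧ w ≠ v) := fun w => by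
    have := Set.ext_iff.1 h w
    simpa using this
  have hx := h1 x
  have hy := h1 y
  have hs := fun a b => G.adj_comm a b
  have hi := fun a => G.irrefl (v := a)
  rw [Equiv.swap_apply_def, Equiv.swap_apply_def]
  split_ifs <;> grind

/-- Let `φ` be a first-order graph formula whose free variables are indexed by `α`
together with one distinguished extra free variable (`Option α`, the distinguished
variable being `none`). If `v` and `v'` have the same type and the assignment `a` of
the `α`-indexed variables avoids both `v` and `v'`, then `φ` is realized in `G` with
the distinguished variable set to `v` iff it is realized with it set to `v'`. -/
theorem realize_sameType_swap {V : Type*} (G : SimpleGraph V) {α : Type*}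
    (φ : Language.graph.Formula (Option α)) (v v' : V) (h : G.SameType v v')
    (a : α → V) (ha : ∀ i : α, a i ≠ v ∧ a i ≠ v') :
    G.Realizes φ (fun j => j.elim v a) ↔ G.Realizes φ (fun j => j.elim v' a) := by
  classical
  letI := G.structure
  let g : V ≃[Language.graph] V :=
    { Equiv.swap v v' with
      map_fun' := fun f => f.elim
      map_rel' := by
        intro n r x
        cases r
        exact sameType_swap_adj G v v' h (x 0) (x 1) }
  have key := FirstOrder.Language.StrongHomClass.realize_formula g φ
    (v := fun j => j.elim v a)
  have e : (g ∘ fun j : Option α => j.elim v a) = fun j => j.elim v' a := by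
    funext j
    cases j with
    | none => exact Equiv.swap_apply_left v v'
    | some i => exact Equiv.swap_apply_of_ne_of_ne (ha i).1 (ha i).2
  rw [e] at key
  exact key.symm
end

section
/- For every finite simple graph G and every edge dominating set S of G, there exists an edge dominating set of G that is a matching and has size at most |S|. Consequently, the minimum size of an edge dominating set of G equals the minimum size of a maximal matching of G. -/
/-- A set `M` of edges of `G` is a matching if its edges are pairwise
vertex-disjoint. -/
def SimpleGraph.IsMatchingSet {V : Type*} (G : SimpleGraph V) (M : Set (Sym2 V)) : Prop :=
  M ⊆ G.edgeSet ∧ ∀ e ∈ M, ∀ e' ∈ M, e ≠ e' → ∀ v : V, ¬(v ∈ e ∧ v ∈ e')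

/-- A set `S` of edges of `G` is an edge dominating set if every edge of `G` shares
at least one endpoint with some edge of `S`. -/
def SimpleGraph.IsEdgeDomSet {V : Type*} (G : SimpleGraph V) (S : Set (Sym2 V)) : Prop :=
  S ⊆ G.edgeSet ∧ ∀ e ∈ G.edgeSet, ∃ e' ∈ S, ∃ v : V, v ∈ e ∧ v ∈ e'

/-- A matching `M` of `G` is maximal if no edge of `G` can be added to it while
keeping it a matching. -/
def SimpleGraph.IsMaximalMatchingSet {V : Type*} (G : SimpleGraph V)
    (M : Set (Sym2 V)) : Prop :=
  G.IsMatchingSet M ∧ ∀ e ∈ G.edgeSet, e ∉ M → ¬ G.IsMatchingSet (insert e M)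

theorem eds_exists_matching {V : Type*} [Fintype V] [DecidableEq V]
    (G : SimpleGraph V) (S : Finset (Sym2 V)) (hS : G.IsEdgeDomSet ↑S) :
      ∃ M : Finset (Sym2 V), G.IsMatchingSet ↑M ∧ G.IsEdgeDomSet ↑M ∧
        M.card ≤ S.card := by
  classical
  let unc : Finset (Sym2 V) → Finset V := fun T => Finset.univ.filter fun v => ∀ e ∈ T, v ∉ e
  obtain ⟨T, hT, hmin⟩ := Finset.exists_min_image
    (Finset.univ.filter fun T : Finset (Sym2 V) => G.IsEdgeDomSet ↑T ∧ T.card ≤ S.card)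
    (fun T => (Fintype.card V + 1) * T.card + (unc T).card) ⟨S, by simp [hS]⟩
  simp only [Finset.mem_filter, Finset.mem_univ, true_and] at hT hmin
  obtain ⟨hTd, hTc⟩ := hT
  refine ⟨T, ⟨hTd.1, ?_⟩, hTd, hTc⟩
  rintro e he f hf hef v ⟨hve, hvf⟩
  have he : e ∈ T := he
  have hf : f ∈ T := hf
  have hcard : (T.erase f).card + 1 = T.card := Finset.card_erase_add_one hf
  have heT : e ∈ T.erase f := Finset.mem_erase.2 ⟨hef, he⟩
  by_cases hd : G.IsEdgeDomSet ↑(T.erase f)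
  · have h1 := hmin _ ⟨hd, by omega⟩
    have h2 : (unc (T.erase f)).card ≤ Fintype.card V := Finset.card_le_univ _
    rw [← hcard] at h1
    nlinarith
  · have hsub : (↑(T.erase f) : Set (Sym2 V)) ⊆ G.edgeSet := fun x hx =>
      hTd.1 (Finset.mem_of_mem_erase hx)
    have : ∃ g ∈ G.edgeSet, ∀ e' ∈ T.erase f, ∀ v, v ∈ g → v ∉ e' := by
      by_contra! hcon
      exact hd ⟨hsub, hcon⟩
    obtain ⟨g, hg, hgn⟩ := this
    obtain ⟨f', hf', w, hwg, hwf'⟩ := hTd.2 g hg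
    have hff : f' = f := by
      by_contra hne
      exact hgn f' (Finset.mem_erase.2 ⟨hne, hf'⟩) w hwg hwf'
    subst hff
    have hvg : v ∉ g := fun h => hgn e heT v h hve
    have hwv : v ≠ w := by rintro rfl; exact hvg hwg
    have hfe : f' = s(v, w) := ((Sym2.mem_and_mem_iff hwv).1 ⟨hvf, hwf'⟩)
    obtain ⟨x, rfl⟩ := Sym2.mem_iff_exists.1 hwg
    have hxw : w ≠ x := G.ne_of_adj hg
    have hxv : x ≠ v := by rintro rfl; exact hvg (by simp)
    have hgT : s(w, x) ∉ T.erase f' := fun h => hgn _ h w (by simp) (by simp)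
    have hcov : ∀ y, (∃ a ∈ T, y ∈ a) → ∃ a ∈ insert s(w, x) (T.erase f'), y ∈ a := by
      rintro y ⟨a, ha, hya⟩
      by_cases haf : a = f'
      · rw [haf, hfe, Sym2.mem_iff] at hya
        rcases hya with rfl | rfl
        · exact ⟨e, Finset.mem_insert_of_mem heT, hve⟩
        · exact ⟨_, Finset.mem_insert_self _ _, by simp⟩
      · exact ⟨a, Finset.mem_insert_of_mem (Finset.mem_erase.2 ⟨haf, ha⟩), hya⟩
    have hc : (insert s(w, x) (T.erase f')).card = T.card := by
      rw [Finset.card_insert_of_notMem hgT, hcard]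
    have h1 := hmin (insert s(w, x) (T.erase f')) ⟨⟨?_, ?_⟩, by omega⟩
    · have h2 : (unc (insert s(w, x) (T.erase f'))).card < (unc T).card := by
        apply Finset.card_lt_card
        rw [Finset.ssubset_iff_of_subset]
        · refine ⟨x, ?_, ?_⟩
          · simp only [unc, Finset.mem_filter, Finset.mem_univ, true_and]
            intro a ha hxa
            by_cases haf : a = f'
            · rw [haf, hfe, Sym2.mem_iff] at hxa
              rcases hxa with h | h
              · exact hxv h
              · exact hxw h.symm
            · exact hgn a (Finset.mem_erase.2 ⟨haf, ha⟩) x (by simp) hxa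
          · simp only [unc, Finset.mem_filter, Finset.mem_univ, true_and]
            intro h
            exact h _ (Finset.mem_insert_self _ _) (by simp)
        · intro y hy
          simp only [unc, Finset.mem_filter, Finset.mem_univ, true_and] at hy ⊢
          intro a ha hya
          obtain ⟨b, hb, hyb⟩ := hcov y ⟨a, ha, hya⟩
          exact hy b hb hyb
      rw [hc] at h1
      omega
    · intro a ha
      rcases Finset.mem_insert.1 ha with rfl | h
      · exact hg
      · exact hsub h
    · intro a ha
      obtain ⟨b, hb, y, hya, hyb⟩ := hTd.2 a ha
      obtain ⟨c, hc, hyc⟩ := hcov y ⟨b, hb, hyb⟩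
      exact ⟨c, hc, y, hya, hyc⟩

theorem maximal_of_eds {V : Type*} (G : SimpleGraph V) (M : Set (Sym2 V))
    (hM : G.IsMatchingSet M) (hd : G.IsEdgeDomSet M) : G.IsMaximalMatchingSet M := by
  refine ⟨hM, fun e he heM h => ?_⟩
  obtain ⟨f, hf, v, hve, hvf⟩ := hd.2 e he
  exact h.2 e (Set.mem_insert _ _) f (Set.mem_insert_of_mem _ hf)
    (by rintro rfl; exact heM hf) v ⟨hve, hvf⟩

theorem eds_of_maximal {V : Type*} (G : SimpleGraph V) (M : Set (Sym2 V))
    (hM : G.IsMaximalMatchingSet M) : G.IsEdgeDomSet M := by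
  refine ⟨hM.1.1, fun e he => ?_⟩
  by_cases heM : e ∈ M
  · exact ⟨e, heM, e.out.1, Sym2.out_fst_mem e, Sym2.out_fst_mem e⟩
  by_contra! hcon
  refine hM.2 e he heM ⟨Set.insert_subset he hM.1.1, ?_⟩
  rintro a (rfl | ha) b (rfl | hb) hab v ⟨hva, hvb⟩
  · exact hab rfl
  · exact hcon b hb v hva hvb
  · exact hcon a ha v hvb hva
  · exact hM.1.2 a ha b hb hab v ⟨hva, hvb⟩

/-- For every finite simple graph `G` and edge dominating set `S`, there is an edge
dominating set which is a matching and has size at most `|S|`; consequently the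
minimum size of an edge dominating set equals the minimum size of a maximal
matching. -/
theorem edgeDominatingSet_vs_maximalMatching {V : Type*} [Fintype V] [DecidableEq V]
    (G : SimpleGraph V) :
    (∀ S : Finset (Sym2 V), G.IsEdgeDomSet ↑S →
      ∃ M : Finset (Sym2 V), G.IsMatchingSet ↑M ∧ G.IsEdgeDomSet ↑M ∧
        M.card ≤ S.card) ∧
    sInf {n : ℕ | ∃ S : Finset (Sym2 V), G.IsEdgeDomSet ↑S ∧ S.card = n} =
      sInf {n : ℕ | ∃ M : Finset (Sym2 V), G.IsMaximalMatchingSet ↑M ∧ M.card = n} := by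
  classical
  refine ⟨fun S hS => eds_exists_matching G S hS, ?_⟩
  have hne : {n : ℕ | ∃ S : Finset (Sym2 V), G.IsEdgeDomSet ↑S ∧ S.card = n}.Nonempty := by
    refine ⟨_, G.edgeFinset, ⟨by simp, fun e he => ?_⟩, rfl⟩
    exact ⟨e, by simpa using he, e.out.1, Sym2.out_fst_mem e, Sym2.out_fst_mem e⟩
  obtain ⟨S, hS, hSc⟩ := Nat.sInf_mem hne
  obtain ⟨M, hM, hMd, hMc⟩ := eds_exists_matching G S hS
  have hMm := maximal_of_eds G _ hM hMd
  apply le_antisymm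
  · obtain ⟨N, hN, hNc⟩ := Nat.sInf_mem
      (s := {n : ℕ | ∃ M : Finset (Sym2 V), G.IsMaximalMatchingSet ↑M ∧ M.card = n})
      ⟨_, M, hMm, rfl⟩
    rw [← hNc]
    exact Nat.sInf_le ⟨N, eds_of_maximal G _ hN, rfl⟩
  · rw [← hSc]
    refine le_trans (Nat.sInf_le ?_) hMc
    exact ⟨M, hMm, rfl⟩
end
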